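/- arXiv:math/0508245 — 2 statements merged into one kernel-verified Lean document; each statement's English description precedes it below -/
import Mathlib

section
/- Let n ≥ 2 and let μ₁, …, μₙ be measures in ℳ_*. Then there exist unique functions Z₁, …, Zₙ in the class 𝒮_* such that for all z ∈ 𝔻 one has Z₁(z)·Z₂(z)·…·Zₙ(z) = z·(Q_{μ₁}(Z₁(z)))^{n−1} and Q_{μ₁}(Z₁(z)) = Q_{μ₂}(Z₂(z)) = ⋯ = Q_{μₙ}(Zₙ(z)). -/
open MeasureTheory Complex Filter Set

/-- Open unit disk. -/
def unitDisk : Set ℂ := Metric.ball 0 1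

/-- The class ℳ_* of Borel probability measures on the unit circle 𝕋
with nonzero first moment. -/
def MStar (μ : Measure ℂ) : Prop :=
  IsProbabilityMeasure μ ∧ μ ((Metric.sphere (0 : ℂ) 1)ᶜ) = 0 ∧ (∫ ξ, ξ ∂μ) ≠ 0

/-- ψ_μ(z) = ∫ zξ/(1 − zξ) dμ(ξ). -/
noncomputable def psiStar (μ : Measure ℂ) (z : ℂ) : ℂ :=
  ∫ ξ, (z * ξ) / (1 - z * ξ) ∂μ

/-- Q_μ = ψ_μ/(1 + ψ_μ). -/
noncomputable def QStar (μ : Measure ℂ) (z : ℂ) : ℂ :=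
  psiStar μ z / (1 + psiStar μ z)

/-- The class 𝒮_*: Schur functions Q with Q(0) = 0 and Q′(0) ≠ 0. -/
def schurStar (Q : ℂ → ℂ) : Prop :=
  DifferentiableOn ℂ Q unitDisk ∧ (∀ z ∈ unitDisk, ‖Q z‖ ≤ 1) ∧
  Q 0 = 0 ∧ deriv Q 0 ≠ 0

open Topology Asymptotics

lemma aux_circle {μ : Measure ℂ} (h : MStar μ) : ∀ᵐ ξ ∂μ, ‖ξ‖ = 1 := by
  have := h.2.1
  rw [ae_iff]
  convert this using 2
  ext x
  simp

lemma aux_low {x ξ : ℂ} (hξ : ‖ξ‖ = 1) : 1 - ‖x‖ ≤ ‖1 - x * ξ‖ := by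
  have := norm_sub_norm_le (1 : ℂ) (x * ξ)
  simpa [hξ] using this

lemma aux_int {μ : Measure ℂ} (h : MStar μ) {z : ℂ} (hz : ‖z‖ < 1) :
    Integrable (fun ξ => (z * ξ) / (1 - z * ξ)) μ := by
  have := h.1
  refine Integrable.of_bound (C := 1 / (1 - ‖z‖)) ?_ ?_
  · exact Measurable.aestronglyMeasurable (by fun_prop)
  · filter_upwards [aux_circle h] with ξ hξ
    rw [norm_div]
    have := aux_low (x := z) hξ
    have h0 : 0 < 1 - ‖z‖ := by linarith
    apply div_le_div₀ zero_le_one _ h0 this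
    simp [hξ, hz.le]

lemma aux_deriv {μ : Measure ℂ} (h : MStar μ) {z : ℂ} (hz : ‖z‖ < 1) :
    HasDerivAt (psiStar μ) (∫ ξ, ξ / (1 - z * ξ) ^ 2 ∂μ) z := by
  have := h.1
  set r := (1 - ‖z‖) / 2 with hr
  have hr0 : 0 < r := by rw [hr]; linarith
  have key : ∀ x ∈ Metric.ball z r, r ≤ 1 - ‖x‖ := by
    intro x hx
    rw [Metric.mem_ball, dist_eq_norm] at hx
    have := norm_sub_norm_le x z
    linarith
  refine (hasDerivAt_integral_of_dominated_loc_of_deriv_le (μ := μ) (𝕜 := ℂ)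
    (F := fun z ξ => (z * ξ) / (1 - z * ξ)) (F' := fun z ξ => ξ / (1 - z * ξ) ^ 2)
    (bound := fun _ => 1 / r ^ 2) (s := Metric.ball z r) (Metric.ball_mem_nhds z hr0) ?_ (aux_int h hz) ?_ ?_
    (integrable_const _) ?_).2
  · exact Eventually.of_forall fun x => Measurable.aestronglyMeasurable (by fun_prop)
  · exact Measurable.aestronglyMeasurable (by fun_prop)
  · filter_upwards [aux_circle h] with ξ hξ x hx
    rw [norm_div, norm_pow, hξ]
    have := aux_low (x := x) hξ
    have := key x hx
    gcongr
    linarith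
  · filter_upwards [aux_circle h] with ξ hξ x hx
    have h1 := aux_low (x := x) hξ
    have h2 := key x hx
    have h3 : (1 - x * ξ) ≠ 0 := by
      rw [← norm_pos_iff]; linarith
    have h4 : HasDerivAt (fun y : ℂ => y * ξ) ξ x := by
      simpa using (hasDerivAt_id x).mul_const ξ
    refine (h4.div (h4.const_sub 1) h3).congr_deriv ?_
    congr 1
    ring

lemma aux_re {μ : Measure ℂ} (h : MStar μ) {z : ℂ} (hz : ‖z‖ < 1) :
    -(1 / 2) ≤ (psiStar μ z).re := by
  have := h.1
  have h1 : (psiStar μ z).re = ∫ ξ, ((z * ξ) / (1 - z * ξ)).re ∂μ := by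
    exact (integral_re (aux_int h hz)).symm
  rw [h1]
  have h2 : (∫ _ξ : ℂ, (-(1 / 2) : ℝ) ∂μ) = -(1/2) := by simp
  rw [← h2]
  refine integral_mono_ae (integrable_const _) (aux_int h hz).re ?_
  filter_upwards [aux_circle h] with ξ hξ
  show -(1 / 2) ≤ ((z * ξ) / (1 - z * ξ)).re
  have hw : ‖z * ξ‖ < 1 := by simpa [hξ] using hz
  have h3 : (1 - z * ξ) ≠ 0 := by
    have := aux_low (x := z) hξ
    rw [← norm_pos_iff]; linarith
  generalize z * ξ = w at *
  have h4 : 0 < normSq (1 - w) := normSq_pos.2 h3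
  have h5 : normSq w < 1 := by
    rw [normSq_eq_norm_sq]
    nlinarith [norm_nonneg w]
  rw [div_re, ← add_div, le_div_iff₀ h4]
  simp only [normSq_apply, sub_re, one_re, sub_im, one_im] at *
  nlinarith

lemma aux_one_add {μ : Measure ℂ} (h : MStar μ) {z : ℂ} (hz : ‖z‖ < 1) :
    1 + psiStar μ z ≠ 0 := by
  intro h0
  have := aux_re h hz
  have h1 := congrArg Complex.re h0
  simp at h1
  linarith

lemma aux_Qdiff {μ : Measure ℂ} (h : MStar μ) : DifferentiableOn ℂ (QStar μ) unitDisk := by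
  intro z hz
  have hz : ‖z‖ < 1 := by simpa [unitDisk] using hz
  have h1 := (aux_deriv h hz).differentiableAt
  exact (h1.div (h1.const_add 1) (aux_one_add h hz)).differentiableWithinAt

lemma aux_Qnorm {μ : Measure ℂ} (h : MStar μ) {z : ℂ} (hz : ‖z‖ < 1) : ‖QStar μ z‖ ≤ 1 := by
  have h1 := aux_re h hz
  rw [QStar, norm_div]
  apply div_le_one_of_le₀ _ (norm_nonneg _)
  rw [Complex.norm_def, Complex.norm_def]
  apply Real.sqrt_le_sqrt
  simp only [normSq_apply, add_re, one_re, add_im, one_im]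
  nlinarith

lemma aux_psi0 (μ : Measure ℂ) : psiStar μ 0 = 0 := by simp [psiStar]

lemma aux_Q0 (μ : Measure ℂ) : QStar μ 0 = 0 := by simp [QStar, aux_psi0]

lemma aux_Qd {μ : Measure ℂ} (h : MStar μ) : deriv (QStar μ) 0 ≠ 0 := by
  have h1 := aux_deriv h (z := 0) (by simp)
  have h2 := h1.div (h1.const_add 1) (aux_one_add h (by simp))
  have h3 : deriv (QStar μ) 0 = _ := h2.deriv
  rw [h3]
  simpa [aux_psi0] using h.2.2

/-- The data of `q` functions. -/
structure QData {n : ℕ} (q : Fin n → ℂ → ℂ) : Prop where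
  diff : ∀ i, DifferentiableOn ℂ (q i) unitDisk
  bd : ∀ i, ∀ z ∈ unitDisk, ‖q i z‖ ≤ 1
  ne : ∀ i, q i 0 ≠ 0

lemma mem_uD {z : ℂ} : z ∈ unitDisk ↔ ‖z‖ < 1 := by simp [unitDisk]

lemma uD_nhds : unitDisk ∈ 𝓝 (0 : ℂ) := Metric.ball_mem_nhds _ one_pos

lemma aux_QData {n : ℕ} (μ : Fin n → Measure ℂ) (hμ : ∀ i, MStar (μ i)) :
    QData (fun i => dslope (QStar (μ i)) 0) where
  diff i := (Complex.differentiableOn_dslope uD_nhds).2 (aux_Qdiff (hμ i))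
  bd i z hz := by
    have := Complex.norm_dslope_le_div_of_mapsTo_ball (R₂ := 1) (aux_Qdiff (hμ i)) ?_ hz
    · simpa using this
    · intro w hw
      have := aux_Qnorm (hμ i) (mem_uD.1 hw)
      simpa [aux_Q0] using this
  ne i := by
    simpa using aux_Qd (hμ i)

lemma aux_Qeq (μ : Measure ℂ) (z : ℂ) : QStar μ z = z * dslope (QStar μ) 0 z := by
  have := sub_smul_dslope (QStar μ) 0 z
  simpa [aux_Q0] using this.symm

/-- The fixed point operator. -/
noncomputable def Gop {n : ℕ} (q : Fin n → ℂ → ℂ) (f : Fin n → ℂ → ℂ) (i : Fin n) (z : ℂ) : ℂ :=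
  z * ∏ j ∈ Finset.univ.erase i, q j (f j z)

/-- Admissible tuples. -/
structure Adm {n : ℕ} (f : Fin n → ℂ → ℂ) : Prop where
  diff : ∀ i, DifferentiableOn ℂ (f i) unitDisk
  bd : ∀ i, ∀ z ∈ unitDisk, ‖f i z‖ ≤ ‖z‖

lemma Adm.maps {n : ℕ} {f : Fin n → ℂ → ℂ} (hf : Adm f) (i : Fin n) :
    MapsTo (f i) unitDisk unitDisk := fun z hz =>
  mem_uD.2 ((hf.bd i z hz).trans_lt (mem_uD.1 hz))

lemma Adm.zero {n : ℕ} {f : Fin n → ℂ → ℂ} (hf : Adm f) (i : Fin n) : f i 0 = 0 := by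
  have := hf.bd i 0 (mem_uD.2 (by simp))
  simpa using this

lemma Adm.tendsto {n : ℕ} {f : Fin n → ℂ → ℂ} (hf : Adm f) (i : Fin n) :
    Tendsto (f i) (𝓝 0) (𝓝 0) := by
  have := ((hf.diff i).differentiableAt uD_nhds).continuousAt.tendsto
  rwa [hf.zero] at this

lemma Gop_adm {n : ℕ} {q f : Fin n → ℂ → ℂ} (hq : QData q) (hf : Adm f) : Adm (Gop q f) where
  diff i := by
    refine DifferentiableOn.mul differentiableOn_id ?_
    exact DifferentiableOn.fun_finsetProd fun j _ => (hq.diff j).comp (hf.diff j) (hf.maps j)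
  bd i z hz := by
    rw [Gop, norm_mul, norm_prod]
    apply mul_le_of_le_one_right (norm_nonneg _)
    exact Finset.prod_le_one (fun _ _ => norm_nonneg _) fun j _ => hq.bd j _ (hf.maps j hz)

lemma prod_bigO {ι : Type*} [DecidableEq ι] (s : Finset ι) (a b : ι → ℂ → ℂ) (g : ℂ → ℝ) (c : ι → ℂ)
    (ha : ∀ i, Tendsto (a i) (𝓝 0) (𝓝 (c i))) (hb : ∀ i, Tendsto (b i) (𝓝 0) (𝓝 (c i)))
    (h : ∀ i, (fun z => a i z - b i z) =O[𝓝 0] g) :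
    (fun z => ∏ i ∈ s, a i z - ∏ i ∈ s, b i z) =O[𝓝 0] g := by
  induction s using Finset.induction_on with
  | empty => simpa using isBigO_zero _ _
  | insert i s hi ih =>
    have h1 : (fun z => a i z) =O[𝓝 0] (fun _ => (1 : ℝ)) := (ha i).isBigO_one ℝ
    have h2 : (fun z => ∏ j ∈ s, b j z) =O[𝓝 0] (fun _ => (1 : ℝ)) :=
      (tendsto_finsetProd s fun j _ => hb j).isBigO_one ℝ
    have h4 := h1.mul ih
    have h5 := (h i).mul h2
    simp only [one_mul, mul_one] at h4 h5
    have h3 := h4.add h5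
    refine h3.congr_left fun z => ?_
    rw [Finset.prod_insert hi, Finset.prod_insert hi]
    ring

lemma step {n : ℕ} {q f g : Fin n → ℂ → ℂ} (hq : QData q) (hf : Adm f) (hg : Adm g) (m : ℕ)
    (h : ∀ i, (fun z => f i z - g i z) =O[𝓝 0] fun z => ‖z‖ ^ m) (i : Fin n) :
    (fun z => Gop q f i z - Gop q g i z) =O[𝓝 0] fun z => ‖z‖ ^ (m + 1) := by
  have hqc : ∀ j, Tendsto (q j) (𝓝 0) (𝓝 (q j 0)) := fun j =>
    ((hq.diff j).differentiableAt uD_nhds).continuousAt.tendsto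
  have h1 : ∀ j, (fun z => q j (f j z) - q j (g j z)) =O[𝓝 0] fun z => ‖z‖ ^ m := by
    intro j
    have h2 := ((hq.diff j).analyticAt uD_nhds).hasStrictFDerivAt.isBigO_sub
    have h3 : Tendsto (fun z => (f j z, g j z)) (𝓝 0) (𝓝 ((0 : ℂ), (0 : ℂ))) :=
      (hf.tendsto j).prodMk_nhds (hg.tendsto j)
    exact (h2.comp_tendsto h3).trans (h j)
  have h4 := prod_bigO (Finset.univ.erase i) _ _ _ (fun j => q j 0)
    (fun j => (hqc j).comp (hf.tendsto j)) (fun j => (hqc j).comp (hg.tendsto j)) h1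
  have h5 : (fun z : ℂ => z) =O[𝓝 0] fun z => ‖z‖ := (isBigO_refl _ _).norm_right
  refine (h5.mul h4).congr (fun z => ?_) fun z => ?_
  · simp only [Gop, Function.comp]; ring
  · ring

lemma schwarz {n : ℕ} {f g : Fin n → ℂ → ℂ} (hf : Adm f) (hg : Adm g) (m : ℕ) (i : Fin n)
    (h : (fun z => f i z - g i z) =O[𝓝 0] fun z => ‖z‖ ^ (m + 1)) {z : ℂ} (hz : z ∈ unitDisk) :
    ‖f i z - g i z‖ ≤ 2 * ‖z‖ ^ (m + 1) := by
  have h0 : f i 0 - g i 0 = 0 := by rw [hf.zero, hg.zero, sub_zero]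
  have := Complex.dist_le_mul_div_pow_of_mapsTo_ball_of_isLittleO (n := m) (R₂ := 2) (z := z)
    (f := fun z => f i z - g i z) (c := 0) (R₁ := 1) ((hf.diff i).sub (hg.diff i)) ?_ ?_ hz
  · simpa [h0] using this
  · intro w hw
    have h1 := hf.bd i w hw
    have h2 := hg.bd i w hw
    have h3 := norm_sub_le (f i w) (g i w)
    have h4 := mem_uD.1 hw
    simp only [h0, mem_closedBall_zero_iff]
    linarith
  · simp only [h0, sub_zero]
    refine h.trans_isLittleO ?_
    have h5 : (fun z : ℂ => ‖z‖) =o[𝓝 0] fun _ => (1 : ℝ) := by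
      rw [isLittleO_one_iff]
      simpa using (continuous_norm (E := ℂ)).tendsto 0
    refine (h5.mul_isBigO (isBigO_refl (fun z : ℂ => ‖z‖ ^ m) _)).congr (fun z => ?_) fun z => ?_
    · ring
    · ring

/-- The iterates. -/
noncomputable def Zit {n : ℕ} (q : Fin n → ℂ → ℂ) : ℕ → Fin n → ℂ → ℂ
  | 0 => fun _ _ => 0
  | k + 1 => Gop q (Zit q k)

lemma Zit_adm {n : ℕ} {q : Fin n → ℂ → ℂ} (hq : QData q) (k : ℕ) : Adm (Zit q k) := by
  induction k with
  | zero => exact ⟨fun i => differentiableOn_const _, fun i z _ => by simp [Zit]⟩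
  | succ k ih => exact Gop_adm hq ih

lemma diffO {n : ℕ} {f g : Fin n → ℂ → ℂ} (hf : Adm f) (hg : Adm g) (i : Fin n) :
    (fun z => f i z - g i z) =O[𝓝 0] fun z => ‖z‖ ^ 0 := by
  simp only [pow_zero]
  exact ((hf.tendsto i).sub (hg.tendsto i)).isBigO_one ℝ

lemma Zit_O {n : ℕ} {q : Fin n → ℂ → ℂ} (hq : QData q) (k : ℕ) (i : Fin n) :
    (fun z => Zit q (k + 1) i z - Zit q k i z) =O[𝓝 0] fun z => ‖z‖ ^ k := by
  induction k generalizing i with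
  | zero => exact diffO (Zit_adm hq _) (Zit_adm hq _) i
  | succ k ih => exact step hq (Zit_adm hq _) (Zit_adm hq _) k ih i

lemma Zit_bd {n : ℕ} {q : Fin n → ℂ → ℂ} (hq : QData q) (k : ℕ) (i : Fin n) {z : ℂ}
    (hz : z ∈ unitDisk) : ‖Zit q (k + 1) i z - Zit q k i z‖ ≤ 2 * ‖z‖ ^ k := by
  cases k with
  | zero =>
    have h1 := (Zit_adm hq 1).bd i z hz
    have h4 := mem_uD.1 hz
    simp [Zit] at h1 ⊢
    linarith
  | succ k => exact schwarz (Zit_adm hq _) (Zit_adm hq _) k i (Zit_O hq (k + 1) i) hz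

/-- The limit. -/
noncomputable def Zlim {n : ℕ} (q : Fin n → ℂ → ℂ) (i : Fin n) (z : ℂ) : ℂ :=
  ∑' k, (Zit q (k + 1) i z - Zit q k i z)

lemma Zlim_tendsto {n : ℕ} {q : Fin n → ℂ → ℂ} (hq : QData q) (i : Fin n) {z : ℂ}
    (hz : z ∈ unitDisk) : Tendsto (fun k => Zit q k i z) atTop (𝓝 (Zlim q i z)) := by
  have hs : Summable fun k => Zit q (k + 1) i z - Zit q k i z :=
    Summable.of_norm_bounded
      ((summable_geometric_of_lt_one (norm_nonneg z) (mem_uD.1 hz)).mul_left 2)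
      fun k => Zit_bd hq k i hz
  have := hs.hasSum.tendsto_sum_nat
  refine this.congr fun k => ?_
  rw [Finset.sum_range_sub (fun k => Zit q k i z)]
  simp [Zit]

lemma Zlim_adm {n : ℕ} {q : Fin n → ℂ → ℂ} (hq : QData q) : Adm (Zlim q) where
  diff i := by
    intro z hz
    obtain ⟨r, hr1, hr2⟩ := exists_between (mem_uD.1 hz)
    have hr0 : 0 ≤ r := (norm_nonneg z).trans hr1.le
    have hsub : Metric.ball (0 : ℂ) r ⊆ unitDisk := Metric.ball_subset_ball hr2.le
    have := Complex.differentiableOn_tsum_of_summable_norm (U := Metric.ball (0 : ℂ) r)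
      (F := fun k z => Zit q (k + 1) i z - Zit q k i z)
      ((summable_geometric_of_lt_one hr0 hr2).mul_left 2)
      (fun k => (((Zit_adm hq (k + 1)).diff i).sub ((Zit_adm hq k).diff i)).mono hsub)
      Metric.isOpen_ball (fun k w hw => (Zit_bd hq k i (hsub hw)).trans (by
        have : ‖w‖ ≤ r := by simpa using (mem_ball_zero_iff.1 hw).le
        gcongr))
    exact (this.differentiableAt (Metric.isOpen_ball.mem_nhds
      (mem_ball_zero_iff.2 hr1))).differentiableWithinAt
  bd i z hz := le_of_tendsto (Zlim_tendsto hq i hz).norm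
    (Eventually.of_forall fun k => (Zit_adm hq k).bd i z hz)

lemma Zlim_fix {n : ℕ} {q : Fin n → ℂ → ℂ} (hq : QData q) (i : Fin n) {z : ℂ}
    (hz : z ∈ unitDisk) : Zlim q i z = Gop q (Zlim q) i z := by
  have h1 := (Zlim_tendsto hq i hz).comp (tendsto_add_atTop_nat 1)
  refine tendsto_nhds_unique h1 ?_
  have h2 : ∀ j, Tendsto (fun k => q j (Zit q k j z)) atTop (𝓝 (q j (Zlim q j z))) := by
    intro j
    have h3 := (Zlim_adm hq).maps j hz
    have h4 := ((hq.diff j).differentiableAt (Metric.isOpen_ball.mem_nhds h3)).continuousAt.tendsto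
    exact h4.comp (Zlim_tendsto hq j hz)
  exact (tendsto_finsetProd _ fun j _ => h2 j).const_mul z

lemma fix_unique {n : ℕ} {q f g : Fin n → ℂ → ℂ} (hq : QData q) (hf : Adm f) (hg : Adm g)
    (hf' : ∀ i, f i =ᶠ[𝓝 0] Gop q f i) (hg' : ∀ i, g i =ᶠ[𝓝 0] Gop q g i) (i : Fin n) {z : ℂ}
    (hz : z ∈ unitDisk) : f i z = g i z := by
  have h1 : ∀ (m : ℕ) (i : Fin n), (fun z => f i z - g i z) =O[𝓝 0] fun z => ‖z‖ ^ m := by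
    intro m
    induction m with
    | zero => exact diffO hf hg
    | succ m ih =>
      intro i
      exact (step hq hf hg m ih i).congr' ((hf' i).sub (hg' i)).symm EventuallyEq.rfl
  have h2 : Tendsto (fun m : ℕ => 2 * ‖z‖ ^ (m + 1)) atTop (𝓝 0) := by
    have := (tendsto_pow_atTop_nhds_zero_of_lt_one (norm_nonneg z) (mem_uD.1 hz)).const_mul 2
    rw [mul_zero] at this
    exact this.comp (tendsto_add_atTop_nat 1)
  have h3 := ge_of_tendsto' h2 fun m => schwarz hf hg m i (h1 (m + 1) i) hz
  exact sub_eq_zero.1 (norm_le_zero_iff.1 h3)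

lemma Zlim_deriv {n : ℕ} {q : Fin n → ℂ → ℂ} (hq : QData q) (i : Fin n) :
    deriv (Zlim q i) 0 ≠ 0 := by
  have hZ := Zlim_adm hq
  have h0 : Zlim q i =ᶠ[𝓝 0] Gop q (Zlim q) i := by
    filter_upwards [uD_nhds] with z hz using Zlim_fix hq i hz
  rw [h0.deriv_eq]
  have hd : DifferentiableAt ℂ (fun z => ∏ j ∈ Finset.univ.erase i, q j (Zlim q j z)) 0 :=
    (DifferentiableOn.fun_finsetProd fun j _ =>
      (hq.diff j).comp (hZ.diff j) (hZ.maps j)).differentiableAt uD_nhds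
  have h1 := ((hasDerivAt_id (0 : ℂ)).mul hd.hasDerivAt).deriv
  have h2 : deriv (Gop q (Zlim q) i) 0 = _ := h1
  rw [h2]
  simp only [id, zero_mul, add_zero, one_mul]
  exact Finset.prod_ne_zero_iff.2 fun j _ => by rw [hZ.zero]; exact hq.ne j

/-- Corollary 2.8: subordination functions for n measures in ℳ_*. -/
theorem multiplicative_subordination_circle_multi (n : ℕ) (hn : 2 ≤ n)
    (μ : Fin n → Measure ℂ) (hμ : ∀ i, MStar (μ i)) :
    ∃ Z : Fin n → ℂ → ℂ, (∀ i, schurStar (Z i)) ∧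
      (∀ z ∈ unitDisk,
        (∏ i, Z i z) =
          z * (QStar (μ ⟨0, by omega⟩) (Z ⟨0, by omega⟩ z)) ^ (n - 1) ∧
        ∀ i, QStar (μ i) (Z i z) = QStar (μ ⟨0, by omega⟩) (Z ⟨0, by omega⟩ z)) ∧
      (∀ W : Fin n → ℂ → ℂ, (∀ i, schurStar (W i)) →
        (∀ z ∈ unitDisk,
          (∏ i, W i z) =
            z * (QStar (μ ⟨0, by omega⟩) (W ⟨0, by omega⟩ z)) ^ (n - 1) ∧
          ∀ i, QStar (μ i) (W i z) = QStar (μ ⟨0, by omega⟩) (W ⟨0, by omega⟩ z)) →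
        ∀ i, ∀ z ∈ unitDisk, W i z = Z i z) := by
  have hq := aux_QData μ hμ
  set q : Fin n → ℂ → ℂ := fun i => dslope (QStar (μ i)) 0 with hqdef
  have hQ : ∀ i z, QStar (μ i) z = z * q i z := fun i z => aux_Qeq (μ i) z
  have hZ := Zlim_adm hq
  have hcard : ∀ i : Fin n, (Finset.univ.erase i).card = n - 1 := by
    intro i; simp [Finset.card_erase_of_mem]
  refine ⟨Zlim q, fun i => ⟨hZ.diff i, fun z hz => (hZ.bd i z hz).trans (mem_uD.1 hz).le,
    hZ.zero i, Zlim_deriv hq i⟩, fun z hz => ?_, fun W hW hWeq i z hz => ?_⟩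
  · have hw : ∀ i, QStar (μ i) (Zlim q i z) = z * ∏ j, q j (Zlim q j z) := by
      intro i
      have h1 : Zlim q i z = z * ∏ j ∈ Finset.univ.erase i, q j (Zlim q j z) := Zlim_fix hq i hz
      rw [hQ, ← Finset.prod_erase_mul _ _ (Finset.mem_univ i), ← mul_assoc, ← h1]
    refine ⟨?_, fun i => by rw [hw, hw]⟩
    let i0 : Fin n := ⟨0, by omega⟩
    have h1 : ∏ j ∈ Finset.univ.erase i0, (Zlim q j z * q j (Zlim q j z)) =
        (z * ∏ j, q j (Zlim q j z)) ^ (n - 1) := by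
      rw [← hcard i0]
      exact Finset.prod_eq_pow_card fun j _ => by rw [← hQ, hw]
    rw [hw, ← h1, Finset.prod_mul_distrib,
      ← Finset.mul_prod_erase _ _ (Finset.mem_univ i0)]
    conv_lhs => rw [Zlim_fix hq i0 hz, Gop]
    ring
  · have hWa : Adm W := by
      refine ⟨fun i => (hW i).1, fun i z hz => ?_⟩
      refine Complex.norm_le_norm_of_mapsTo_ball (R := 1) (hW i).1 ?_ (hW i).2.2.1 (mem_uD.1 hz)
      intro w hw
      simpa using (hW i).2.1 w hw
    refine fix_unique hq hWa hZ (fun i => ?_) (fun i => ?_) i hz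
    · have hne : ∀ᶠ z in 𝓝[≠] (0 : ℂ), ∀ j, W j z ≠ 0 := by
        rw [eventually_all]
        intro j
        have := (((hW j).1.differentiableAt uD_nhds).hasDerivAt).eventually_ne (hW j).2.2.2
          (c := 0)
        exact this
      rw [eventually_nhdsWithin_iff] at hne
      filter_upwards [hne, uD_nhds] with w hw hwD
      rcases eq_or_ne w 0 with rfl | hw0
      · simp [Gop, hWa.zero]
      · have hw := hw hw0
        obtain ⟨e1, e2⟩ := hWeq w hwD
        have h1 : ∏ j ∈ Finset.univ.erase i, (W j w * q j (W j w)) =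
            (QStar (μ ⟨0, by omega⟩) (W ⟨0, by omega⟩ w)) ^ (n - 1) := by
          rw [← hcard i]
          exact Finset.prod_eq_pow_card fun j _ => by rw [← hQ, e2]
        rw [← h1, Finset.prod_mul_distrib, ← Finset.mul_prod_erase _ _ (Finset.mem_univ i)] at e1
        have h2 : ∏ j ∈ Finset.univ.erase i, W j w ≠ 0 :=
          Finset.prod_ne_zero_iff.2 fun j _ => hw j
        apply mul_right_cancel₀ h2
        rw [e1, Gop]
        ring
    · filter_upwards [uD_nhds] with w hw using Zlim_fix hq i hw
end

section
/- Let μ be a measure in ℳ_* and let n ≥ 2 be an integer. Then there exists a unique function Z in the class 𝒮_* such that (Z(z))ⁿ = z·(Q_μ(Z(z)))^{n−1} for all z ∈ 𝔻. -/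
open MeasureTheory Complex Filter Set

open Metric in
theorem fixed_lip (f : ℂ → ℂ) (hf : DifferentiableOn ℂ f (ball 0 1)) :
    ∃ K : ℝ, 0 ≤ K ∧ ∃ t ∈ nhds (0:ℂ), ∀ a ∈ t, ∀ b ∈ t, ‖f a - f b‖ ≤ K * ‖a - b‖ := by
  have h0 : ball (0:ℂ) 1 ∈ nhds 0 := ball_mem_nhds _ one_pos
  obtain ⟨K, t, ht, hK⟩ := ((hf.analyticAt h0).contDiffAt (n := 1)).exists_lipschitzOnWith
  refine ⟨K, K.2, t, ht, fun a ha b hb => ?_⟩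
  simpa [dist_eq_norm] using hK.dist_le_mul a ha b hb

noncomputable def iterZ (f : ℂ → ℂ) : ℕ → ℂ → ℂ
  | 0 => fun _ => 0
  | k + 1 => fun z => z * f (iterZ f k z)

open Metric in
theorem iterZ_props (f : ℂ → ℂ) (hf : DifferentiableOn ℂ f (ball 0 1))
    (hb : ∀ z ∈ ball (0:ℂ) 1, ‖f z‖ ≤ 1) (k : ℕ) :
    DifferentiableOn ℂ (iterZ f k) (ball 0 1) ∧ ∀ z ∈ ball (0:ℂ) 1, ‖iterZ f k z‖ ≤ ‖z‖ := by
  induction k with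
  | zero => exact ⟨differentiableOn_const _, fun z _ => by simp [iterZ]⟩
  | succ k ih =>
    have hm : MapsTo (iterZ f k) (ball 0 1) (ball 0 1) := fun z hz => by
      have := ih.2 z hz
      rw [mem_ball_zero_iff] at hz ⊢
      linarith
    refine ⟨differentiableOn_id.mul (hf.comp ih.1 hm), fun z hz => ?_⟩
    simp only [iterZ, norm_mul]
    exact mul_le_of_le_one_right (norm_nonneg _) (hb _ (hm hz))

open Metric Asymptotics in
theorem iterZ_littleO (f : ℂ → ℂ) (hf : DifferentiableOn ℂ f (ball 0 1))
    (hb : ∀ z ∈ ball (0:ℂ) 1, ‖f z‖ ≤ 1) (k : ℕ) :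
    (fun z => iterZ f (k+1) z - iterZ f k z) =o[nhds 0] (fun z => ‖z‖ ^ k) := by
  have h0 : ball (0:ℂ) 1 ∈ nhds 0 := ball_mem_nhds _ one_pos
  have hc : ∀ k, Tendsto (iterZ f k) (nhds 0) (nhds 0) := fun k => by
    have h := ((iterZ_props f hf hb k).1.continuousOn.continuousAt h0).tendsto
    have h2 := (iterZ_props f hf hb k).2 0 (by simp)
    have : iterZ f k 0 = 0 := by simpa using h2
    rwa [this] at h
  induction k with
  | zero =>
    simp only [pow_zero, isLittleO_one_iff]
    simpa using (hc 1).sub (hc 0)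
  | succ k ih =>
    obtain ⟨K, hK, t, ht, hL⟩ := fixed_lip f hf
    have hO : (fun z => f (iterZ f (k+1) z) - f (iterZ f k z)) =O[nhds 0]
        (fun z => iterZ f (k+1) z - iterZ f k z) := by
      refine IsBigO.of_bound K ?_
      filter_upwards [hc (k+1) ht, hc k ht] with z h1 h2
      exact hL _ h1 _ h2
    have h3 : (fun z : ℂ => z) =O[nhds 0] (fun z : ℂ => ‖z‖) := (isBigO_refl _ _).norm_right
    have := h3.mul_isLittleO (hO.trans_isLittleO ih)
    refine this.congr (fun z => ?_) (fun z => ?_)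
    · simp only [iterZ]; ring
    · ring

open Metric in
theorem iterZ_diff (f : ℂ → ℂ) (hf : DifferentiableOn ℂ f (ball 0 1))
    (hb : ∀ z ∈ ball (0:ℂ) 1, ‖f z‖ ≤ 1) (k : ℕ) (z : ℂ) (hz : z ∈ ball (0:ℂ) 1) :
    ‖iterZ f (k+1) z - iterZ f k z‖ ≤ 2 * ‖z‖ ^ (k+1) := by
  have p1 := iterZ_props f hf hb (k+1)
  have p0 := iterZ_props f hf hb k
  have e1 : iterZ f (k+1) 0 = 0 := by simpa using p1.2 0 (by simp)
  have e0 : iterZ f k 0 = 0 := by simpa using p0.2 0 (by simp)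
  have := Complex.dist_le_mul_div_pow_of_mapsTo_ball_of_isLittleO
    (f := fun z => iterZ f (k+1) z - iterZ f k z) (c := 0) (R₁ := 1) (R₂ := 2) (n := k)
    (p1.1.sub p0.1) (fun w hw => ?_) (by simpa [e1, e0] using iterZ_littleO f hf hb k) hz
  · simpa [e1, e0] using this
  · have a := p1.2 w hw
    have b := p0.2 w hw
    have c := norm_sub_le (iterZ f (k+1) w) (iterZ f k w)
    rw [mem_ball_zero_iff] at hw
    simp only [e1, e0, sub_zero, mem_closedBall_zero_iff]
    linarith

open Metric in
theorem fixed_exists (f : ℂ → ℂ) (hf : DifferentiableOn ℂ f (ball 0 1))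
    (hb : ∀ z ∈ ball (0:ℂ) 1, ‖f z‖ ≤ 1) :
    ∃ Z : ℂ → ℂ, DifferentiableOn ℂ Z (ball 0 1) ∧
      ∀ z ∈ ball (0:ℂ) 1, ‖Z z‖ ≤ ‖z‖ ∧ Z z = z * f (Z z) := by
  let d : ℕ → ℂ → ℂ := fun k z => iterZ f (k+1) z - iterZ f k z
  have hd : ∀ k, DifferentiableOn ℂ (d k) (ball 0 1) := fun k =>
    (iterZ_props f hf hb (k+1)).1.sub (iterZ_props f hf hb k).1
  refine ⟨fun z => ∑' k, d k z, ?_, ?_⟩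
  · intro z hz
    have hz' := mem_ball_zero_iff.1 hz
    obtain ⟨r, hr1, hr2⟩ := exists_between hz'
    have hr0 : 0 ≤ r := (norm_nonneg z).trans hr1.le
    have hs : Summable (fun k : ℕ => 2 * r ^ (k+1)) :=
      (((summable_geometric_of_lt_one hr0 hr2).mul_left r).congr
        (fun k => by ring : ∀ k : ℕ, r * r ^ k = r ^ (k+1))).mul_left 2
    have sub : ball (0:ℂ) r ⊆ ball 0 1 := ball_subset_ball hr2.le
    have := Complex.differentiableOn_tsum_of_summable_norm hs (fun k => (hd k).mono sub)
      isOpen_ball (fun k w hw => (iterZ_diff f hf hb k w (sub hw)).trans (by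
        have := (mem_ball_zero_iff.1 hw).le
        gcongr))
    exact (this.differentiableAt (isOpen_ball.mem_nhds
      (mem_ball_zero_iff.2 hr1))).differentiableWithinAt
  · intro z hz
    have hz' := mem_ball_zero_iff.1 hz
    have hs : Summable (fun k : ℕ => 2 * ‖z‖ ^ (k+1)) :=
      (((summable_geometric_of_lt_one (norm_nonneg z) hz').mul_left ‖z‖).congr
        (fun k => by ring : ∀ k : ℕ, ‖z‖ * ‖z‖ ^ k = ‖z‖ ^ (k+1))).mul_left 2
    have hsum : Summable (fun k => d k z) :=
      Summable.of_norm_bounded hs (fun k => iterZ_diff f hf hb k z hz)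
    have ht := hsum.hasSum.tendsto_sum_nat
    have heq : ∀ N, ∑ k ∈ Finset.range N, d k z = iterZ f N z := fun N => by
      simp only [d]
      rw [Finset.sum_range_sub (fun k => iterZ f k z)]
      simp [iterZ]
    simp only [heq] at ht
    have hle : ‖∑' k, d k z‖ ≤ ‖z‖ :=
      le_of_tendsto ht.norm (Eventually.of_forall fun N => (iterZ_props f hf hb N).2 z hz)
    refine ⟨hle, ?_⟩
    have hc : ContinuousAt f (∑' k, d k z) :=
      hf.continuousOn.continuousAt (isOpen_ball.mem_nhds (mem_ball_zero_iff.2 (hle.trans_lt hz')))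
    have h1 : Tendsto (fun N => iterZ f (N+1) z) atTop (nhds (z * f (∑' k, d k z))) :=
      (hc.tendsto.comp ht).const_mul z
    exact tendsto_nhds_unique (ht.comp (tendsto_add_atTop_nat 1)) h1

open Metric in
theorem fixed_unique (f : ℂ → ℂ) (hf : DifferentiableOn ℂ f (ball 0 1)) (Z W : ℂ → ℂ)
    (hZ : DifferentiableOn ℂ Z (ball 0 1)) (hW : DifferentiableOn ℂ W (ball 0 1))
    (hZ0 : Z 0 = 0) (hW0 : W 0 = 0)
    (eZ : ∀ᶠ z in nhds (0:ℂ), Z z = z * f (Z z)) (eW : ∀ᶠ z in nhds (0:ℂ), W z = z * f (W z)) :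
    EqOn W Z (ball 0 1) := by
  have h0 : ball (0:ℂ) 1 ∈ nhds 0 := ball_mem_nhds _ one_pos
  obtain ⟨K, hK, t, ht, hL⟩ := fixed_lip f hf
  have cZ : Tendsto Z (nhds 0) (nhds 0) := by
    simpa [hZ0] using (hZ.continuousOn.continuousAt h0).tendsto
  have cW : Tendsto W (nhds 0) (nhds 0) := by
    simpa [hW0] using (hW.continuousOn.continuousAt h0).tendsto
  refine (hW.analyticOnNhd isOpen_ball).eqOn_of_preconnected_of_eventuallyEq
    (hZ.analyticOnNhd isOpen_ball) (convex_ball _ _).isPreconnected (mem_ball_self one_pos) ?_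
  have hsmall : ∀ᶠ z : ℂ in nhds 0, ‖z‖ * K < 1 := by
    have : Tendsto (fun z : ℂ => ‖z‖ * K) (nhds 0) (nhds 0) := by
      have : Continuous (fun z : ℂ => ‖z‖ * K) := by fun_prop
      simpa using this.tendsto 0
    exact this.eventually (gt_mem_nhds one_pos)
  filter_upwards [eZ, eW, cZ ht, cW ht, hsmall] with z h1 h2 h3 h4 h5
  have h6 : ‖W z - Z z‖ ≤ ‖z‖ * K * ‖W z - Z z‖ := by
    calc ‖W z - Z z‖ = ‖z‖ * ‖f (W z) - f (Z z)‖ := by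
          rw [← norm_mul, mul_sub, ← h1, ← h2]
      _ ≤ ‖z‖ * (K * ‖W z - Z z‖) := by gcongr; exact hL _ h4 _ h3
      _ = _ := by ring
  have h7 : ‖W z - Z z‖ = 0 := by
    by_contra hne
    have : 0 < ‖W z - Z z‖ := lt_of_le_of_ne (norm_nonneg _) (Ne.symm hne)
    nlinarith
  exact sub_eq_zero.1 (norm_eq_zero.1 h7)

theorem re_kernel (u : ℂ) (hu : ‖u‖ < 1) : -(1/2) ≤ (u / (1 - u)).re := by
  have hne : 1 - u ≠ 0 := fun h => by
    have : u = 1 := (sub_eq_zero.1 h).symm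
    simp [this] at hu
  have hp : 0 < Complex.normSq (1 - u) := Complex.normSq_pos.2 hne
  have h1 : Complex.normSq u < 1 := by
    rw [Complex.normSq_eq_norm_sq]; nlinarith [norm_nonneg u]
  rw [Complex.div_re, ← add_div, le_div_iff₀ hp]
  simp only [Complex.normSq_apply, Complex.sub_re, Complex.sub_im, Complex.one_re,
    Complex.one_im] at *
  nlinarith

open Metric in
theorem psi_props (μ : Measure ℂ) (hμ : MStar μ) (z : ℂ) (hz : z ∈ ball (0:ℂ) 1) :
    HasDerivAt (psiStar μ) (∫ ξ, ξ / (1 - z * ξ) ^ 2 ∂μ) z ∧ -(1/2) ≤ (psiStar μ z).re := by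
  obtain ⟨hp, hs, -⟩ := hμ
  have hae : ∀ᵐ ξ ∂μ, ‖ξ‖ = 1 := by
    have : ∀ᵐ ξ ∂μ, ξ ∈ sphere (0:ℂ) 1 := hs
    filter_upwards [this] with ξ h
    simpa using h
  have hz' := mem_ball_zero_iff.1 hz
  obtain ⟨r, hr1, hr2⟩ := exists_between hz'
  have hlow : ∀ w : ℂ, ‖w‖ < r → ∀ ξ : ℂ, ‖ξ‖ = 1 → 1 - r ≤ ‖1 - w * ξ‖ := fun w hw ξ hξ => by
    have := norm_sub_norm_le 1 (w * ξ)
    rw [norm_mul, hξ, norm_one] at this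
    linarith
  have hr : 0 < 1 - r := by linarith
  have hmeas : ∀ w : ℂ, AEStronglyMeasurable (fun ξ : ℂ => w * ξ / (1 - w * ξ)) μ := fun w =>
    (by fun_prop : Measurable (fun ξ : ℂ => w * ξ / (1 - w * ξ))).aestronglyMeasurable
  have hint : Integrable (fun ξ : ℂ => z * ξ / (1 - z * ξ)) μ := by
    refine Integrable.of_bound (hmeas z) (1 / (1 - r)) ?_
    filter_upwards [hae] with ξ hξ
    rw [norm_div]
    have := hlow z hr1 ξ hξ
    gcongr
    rw [norm_mul, hξ]; linarith
  constructor
  · refine (hasDerivAt_integral_of_dominated_loc_of_deriv_le (s := ball 0 r)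
      (F := fun w ξ => w * ξ / (1 - w * ξ)) (F' := fun w ξ => ξ / (1 - w * ξ) ^ 2)
      (bound := fun _ => 1 / (1 - r) ^ 2)
      (isOpen_ball.mem_nhds (mem_ball_zero_iff.2 hr1))
      (Eventually.of_forall hmeas) hint ?_ ?_ (integrable_const _) ?_).2
    · exact (by fun_prop : Measurable (fun ξ : ℂ => ξ / (1 - z * ξ) ^ 2)).aestronglyMeasurable
    · filter_upwards [hae] with ξ hξ w hw
      have := hlow w (mem_ball_zero_iff.1 hw) ξ hξ
      rw [norm_div, norm_pow, hξ]
      gcongr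
    · filter_upwards [hae] with ξ hξ w hw
      have := hlow w (mem_ball_zero_iff.1 hw) ξ hξ
      have hne : 1 - w * ξ ≠ 0 := norm_pos_iff.1 (hr.trans_le this)
      have h1 : HasDerivAt (fun w : ℂ => w * ξ) ξ w := by
        simpa using (hasDerivAt_id w).mul_const ξ
      have h2 := h1.div (h1.const_sub 1) hne
      refine h2.congr_deriv ?_
      congr 1
      ring
  · have h1 : (psiStar μ z).re = ∫ ξ, (z * ξ / (1 - z * ξ)).re ∂μ := by
      unfold psiStar
      exact (integral_re hint).symm
    have h2 : ∫ ξ, (-(1/2) : ℝ) ∂μ ≤ ∫ ξ, (z * ξ / (1 - z * ξ)).re ∂μ := by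
      refine integral_mono_ae (integrable_const _) hint.re ?_
      filter_upwards [hae] with ξ hξ
      exact re_kernel _ (by rw [norm_mul, hξ, mul_one]; exact hz')
    rw [h1]
    simpa using h2

open Metric in
theorem Q_props (μ : Measure ℂ) (hμ : MStar μ) :
    DifferentiableOn ℂ (QStar μ) (ball 0 1) ∧ (∀ z ∈ ball (0:ℂ) 1, ‖QStar μ z‖ ≤ 1) ∧
    QStar μ 0 = 0 ∧ deriv (QStar μ) 0 ≠ 0 := by
  have hne : ∀ z ∈ ball (0:ℂ) 1, 1 + psiStar μ z ≠ 0 := fun z hz h => by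
    have h1 := (psi_props μ hμ z hz).2
    have h2 := congrArg Complex.re h
    simp at h2
    linarith
  have hpsi0 : psiStar μ 0 = 0 := by simp [psiStar]
  refine ⟨fun z hz => ?_, fun z hz => ?_, by simp [QStar, hpsi0], ?_⟩
  · have := (psi_props μ hμ z hz).1.differentiableAt
    exact (this.div (this.const_add 1) (hne z hz)).differentiableWithinAt
  · have h1 := (psi_props μ hμ z hz).2
    rw [QStar, norm_div, div_le_one (norm_pos_iff.2 (hne z hz))]
    rw [← sq_le_sq₀ (norm_nonneg _) (norm_nonneg _), ← Complex.normSq_eq_norm_sq,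
      ← Complex.normSq_eq_norm_sq]
    simp only [Complex.normSq_apply, Complex.add_re, Complex.add_im, Complex.one_re,
      Complex.one_im]
    nlinarith
  · have h := (psi_props μ hμ 0 (mem_ball_self one_pos)).1
    have h2 := h.div (h.const_add 1) (hne 0 (mem_ball_self one_pos))
    have h3 : deriv (QStar μ) 0 = ∫ ξ, ξ ∂μ := by
      refine (HasDerivAt.deriv (f := QStar μ) h2).trans ?_
      simp [hpsi0]
    rw [h3]
    exact hμ.2.2

/-- Corollary 2.9: subordination function for the n-fold multiplicative free
convolution power on the unit circle. -/
theorem multiplicative_subordination_circle_power (μ : Measure ℂ) (hμ : MStar μ)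
    (n : ℕ) (hn : 2 ≤ n) :
    ∃ Z : ℂ → ℂ, schurStar Z ∧
      (∀ z ∈ unitDisk, (Z z) ^ n = z * (QStar μ (Z z)) ^ (n - 1)) ∧
      (∀ W : ℂ → ℂ, schurStar W →
        (∀ z ∈ unitDisk, (W z) ^ n = z * (QStar μ (W z)) ^ (n - 1)) →
        ∀ z ∈ unitDisk, W z = Z z) := by
  obtain ⟨hQ, hQb, hQ0, hQd⟩ := Q_props μ hμ
  have h0 : Metric.ball (0:ℂ) 1 ∈ nhds 0 := Metric.ball_mem_nhds _ one_pos
  have hD : unitDisk = Metric.ball 0 1 := rfl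
  set h : ℂ → ℂ := dslope (QStar μ) 0 with hh
  have hQh : ∀ w, QStar μ w = w * h w := fun w => by
    have := sub_smul_dslope (QStar μ) 0 w
    simpa [hQ0] using this.symm
  have hhd : DifferentiableOn ℂ h (Metric.ball 0 1) :=
    (Complex.differentiableOn_dslope h0).2 hQ
  have hhb : ∀ z ∈ Metric.ball (0:ℂ) 1, ‖h z‖ ≤ 1 := fun z hz => by
    have := Complex.norm_dslope_le_div_of_mapsTo_ball (R₂ := 1) hQ
      (fun w hw => by simpa [hQ0] using hQb w hw) hz
    simpa using this
  have hh0 : h 0 ≠ 0 := by rw [hh, dslope_same]; exact hQd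
  set f : ℂ → ℂ := fun w => h w ^ (n - 1) with hf
  have hfd : DifferentiableOn ℂ f (Metric.ball 0 1) := hhd.pow _
  have hfb : ∀ z ∈ Metric.ball (0:ℂ) 1, ‖f z‖ ≤ 1 := fun z hz => by
    rw [hf]; simp only [norm_pow]
    exact pow_le_one₀ (norm_nonneg _) (hhb z hz)
  obtain ⟨m, rfl⟩ : ∃ m, n = m + 1 := ⟨n - 1, by omega⟩
  obtain ⟨Z, hZd, hZ⟩ := fixed_exists f hfd hfb
  have hZ0 : Z 0 = 0 := by simpa using (hZ 0 (by simp)).1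
  have key : ∀ z w : ℂ, z * QStar μ w ^ (m + 1 - 1) = w ^ m * (z * f w) := fun z w => by
    rw [hQh, hf]; simp only [Nat.add_sub_cancel, mul_pow]; ring
  refine ⟨Z, ⟨hZd, fun z hz => ?_, hZ0, ?_⟩, fun z hz => ?_, fun W hW hWe => ?_⟩
  · exact (hZ z hz).1.trans (mem_ball_zero_iff.1 hz).le
  · have e : Z =ᶠ[nhds 0] fun z => z * f (Z z) := by
      filter_upwards [h0] with z hz using (hZ z hz).2
    have h1 : DifferentiableAt ℂ Z 0 := hZd.differentiableAt h0
    have h2 : DifferentiableAt ℂ f (Z 0) := by rw [hZ0]; exact hfd.differentiableAt h0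
    have h3 := (hasDerivAt_id (0:ℂ)).mul (h2.comp 0 h1).hasDerivAt
    have h4 : deriv Z 0 = f 0 := by
      rw [e.deriv_eq]
      refine (HasDerivAt.deriv (f := fun z => z * f (Z z)) h3).trans ?_
      simp [hZ0]
    rw [h4]
    exact pow_ne_zero _ hh0
  · rw [key, ← (hZ z hz).2, pow_succ]
  · obtain ⟨hWd, hWb, hW0, hW1⟩ := hW
    refine fixed_unique f hfd Z W hZd hWd hZ0 hW0 ?_ ?_
    · filter_upwards [h0] with z hz using (hZ z hz).2
    · have hdiff : HasDerivAt W (deriv W 0) 0 := (hWd.differentiableAt h0).hasDerivAt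
      have hne : ∀ᶠ z in nhdsWithin (0:ℂ) {0}ᶜ, W z ≠ 0 := by
        simpa [hW0] using hdiff.eventually_ne hW1 (c := (0:ℂ))
      rw [eventually_nhdsWithin_iff] at hne
      filter_upwards [hne, h0] with z h1 hz
      by_cases hz0 : z = 0
      · simp [hz0, hW0]
      · have h2 := hWe z hz
        rw [key, pow_succ] at h2
        exact mul_left_cancel₀ (pow_ne_zero _ (h1 hz0)) h2
end
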